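/- arXiv:2111.01851 — 7 statements merged into one kernel-verified Lean document; each statement's English description precedes it below -/
import Mathlib

section
/- Almost-everywhere independence of the allocation from the reported valuation function: Let (x,p) be an EPIC-IR mechanism. Fix an agent i and a profile (v_{-i}, s_{-i}) of the other agents' valuations and signals. Let v_i, v̂_i ∈ V be valuation functions such that t ↦ v_i(t_i, s_{-i}) and t ↦ v̂_i(t_i, s_{-i}) are continuous and strictly increasing on [0,1], with inverse functions v_i^{-1} and v̂_i^{-1} defined on [v_i(0_i, s_{-i}), v_i(1_i, s_{-i})] and [v̂_i(0_i, s_{-i}), v̂_i(1_i, s_{-i})] respectively. Set L = max{v_i(0_i, s_{-i}), v̂_i(0_i, s_{-i})} and U = min{v_i(1_i, s_{-i}), v̂_i(1_i, s_{-i})}, and assume L ≤ U. Assume moreover that the functions y ↦ x_i((v_i, v_{-i}), (v_i^{-1}(y)_i, s_{-i})) and y ↦ x_i((v̂_i, v_{-i}), (v̂_i^{-1}(y)_i, s_{-i})) are Lebesgue integrable on [L, U]. Then these two functions are equal almost everywhere (with respect to Lebesgue measure) on [L, U]. -/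
open Function

/-- A signal profile: each of the `n` agents has a signal in `[0,1]`. -/
abbrev Sig (n : ℕ) := Fin n → unitInterval

/-- A valid valuation function: nonnegative and monotone non-decreasing in each coordinate. -/
def ValidVal {n : ℕ} (v : Sig n → ℝ) : Prop :=
  (∀ s, 0 ≤ v s) ∧ Monotone v

/-- Ex-post incentive compatibility. -/
def EPIC (n : ℕ) (x p : (Fin n → Sig n → ℝ) → Sig n → Fin n → ℝ) : Prop :=
  ∀ (v : Fin n → Sig n → ℝ) (s : Sig n) (i : Fin n) (v' : Sig n → ℝ) (s' : unitInterval),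
    (∀ j, ValidVal (v j)) → ValidVal v' →
    v i s * x v s i - p v s i ≥
      v i s * x (Function.update v i v') (Function.update s i s') i -
        p (Function.update v i v') (Function.update s i s') i

/-- Ex-post individual rationality. -/
def EPIR (n : ℕ) (x p : (Fin n → Sig n → ℝ) → Sig n → Fin n → ℝ) : Prop :=
  ∀ (v : Fin n → Sig n → ℝ) (s : Sig n) (i : Fin n),
    (∀ j, ValidVal (v j)) → 0 ≤ v i s * x v s i - p v s i

/-- Two functions on `[L, U]` whose cross increments are monotone agree almost everywhere. -/
theorem ae_eq_of_cross (a b : ℝ → ℝ) (L U : ℝ)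
    (h : ∀ y ∈ Set.Icc L U, ∀ z ∈ Set.Icc L U, 0 ≤ (y - z) * (a y - b z)) :
    ∀ᵐ y ∂(MeasureTheory.volume.restrict (Set.Icc L U)), a y = b y := by
  have h1 : ∀ y ∈ Set.Icc L U, ∀ z ∈ Set.Icc L U, z < y → b z ≤ a y := by
    intro y hy z hz hlt
    have := nonneg_of_mul_nonneg_right (h y hy z hz) (sub_pos.2 hlt)
    linarith
  have h2 : ∀ y ∈ Set.Icc L U, ∀ z ∈ Set.Icc L U, y < z → a y ≤ b z := by
    intro y hy z hz hlt
    have h0 := h y hy z hz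
    have h0' : 0 ≤ (z - y) * (b z - a y) := by nlinarith
    have := nonneg_of_mul_nonneg_right h0' (sub_pos.2 hlt)
    linarith
  have hm : MonotoneOn a (Set.Icc L U) := by
    intro y hy w hw hyw
    rcases hyw.eq_or_lt with rfl | hlt
    · exact le_rfl
    · obtain ⟨z, hz1, hz2⟩ := exists_between hlt
      have hz : z ∈ Set.Icc L U := ⟨hy.1.trans hz1.le, hz2.le.trans hw.2⟩
      exact (h2 y hy z hz hz1).trans (h1 w hw z hz hz2)
  have hc := hm.countable_not_continuousWithinAt
  have hc2 := (hc.union ((Set.countable_singleton L).union (Set.countable_singleton U)))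
  rw [MeasureTheory.ae_restrict_iff' measurableSet_Icc]
  filter_upwards [hc2.ae_notMem MeasureTheory.volume] with z hz hzI
  simp only [Set.mem_union, Set.mem_ofPred_eq, Set.mem_singleton_iff, not_or, not_and, not_not]
    at hz
  obtain ⟨hz1, hzL, hzU⟩ := hz
  have hL : L < z := lt_of_le_of_ne hzI.1 (Ne.symm hzL)
  have hU : z < U := lt_of_le_of_ne hzI.2 hzU
  have hnear := Icc_mem_nhds hL hU
  have hca : ContinuousAt a z := (hz1 hzI).continuousAt hnear
  apply le_antisymm
  · refine le_of_tendsto (hca.tendsto.mono_left (nhdsWithin_le_nhds (s := Set.Iio z))) ?_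
    filter_upwards [self_mem_nhdsWithin, nhdsWithin_le_nhds hnear] with y hy hyI
    exact h2 y hyI z hzI hy
  · refine ge_of_tendsto (hca.tendsto.mono_left (nhdsWithin_le_nhds (s := Set.Ioi z))) ?_
    filter_upwards [self_mem_nhdsWithin, nhdsWithin_le_nhds hnear] with y hy hyI
    exact h1 y hyI z hzI hy

/-- almost-everywhere independence of the allocation from the reported
valuation function.  For an EPIC-IR mechanism, fixing agent `i` and the others'
reports, if `v_i` and `v̂_i` are continuous and strictly increasing in `i`'s signal,
with inverses `ginv` and `ghat` on the corresponding value ranges, then on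
`[L, U] = [max of the two lowest values, min of the two highest values]` the two
allocation curves `y ↦ x_i((v_i, v_{-i}), (v_i^{-1}(y)_i, s_{-i}))` and
`y ↦ x_i((v̂_i, v_{-i}), (v̂_i^{-1}(y)_i, s_{-i}))` agree Lebesgue-almost everywhere. -/
theorem stmt3 (n : ℕ)
    (x p : (Fin n → Sig n → ℝ) → Sig n → Fin n → ℝ)
    (hrange : ∀ v s i, (∀ j, ValidVal (v j)) → x v s i ∈ Set.Icc (0:ℝ) 1)
    (hIC : EPIC n x p) (hIR : EPIR n x p)
    (i : Fin n) (v : Fin n → Sig n → ℝ) (s : Sig n)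
    (hval : ∀ j, ValidVal (v j))
    (vhat : Sig n → ℝ) (hvhat : ValidVal vhat)
    (hcont : Continuous fun t : unitInterval => v i (Function.update s i t))
    (hmono : StrictMono fun t : unitInterval => v i (Function.update s i t))
    (hcont' : Continuous fun t : unitInterval => vhat (Function.update s i t))
    (hmono' : StrictMono fun t : unitInterval => vhat (Function.update s i t))
    (ginv ghat : ℝ → unitInterval)
    (hginv : ∀ y ∈ Set.Icc (v i (Function.update s i 0)) (v i (Function.update s i 1)),
      v i (Function.update s i (ginv y)) = y)
    (hghat : ∀ y ∈ Set.Icc (vhat (Function.update s i 0)) (vhat (Function.update s i 1)),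
      vhat (Function.update s i (ghat y)) = y)
    (L U : ℝ)
    (hL : L = max (v i (Function.update s i 0)) (vhat (Function.update s i 0)))
    (hU : U = min (v i (Function.update s i 1)) (vhat (Function.update s i 1)))
    (hLU : L ≤ U)
    (hint1 : MeasureTheory.IntegrableOn
      (fun y : ℝ => x v (Function.update s i (ginv y)) i) (Set.Icc L U))
    (hint2 : MeasureTheory.IntegrableOn
      (fun y : ℝ => x (Function.update v i vhat) (Function.update s i (ghat y)) i)
      (Set.Icc L U)) :
    ∀ᵐ y ∂(MeasureTheory.volume.restrict (Set.Icc L U)),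
      x v (Function.update s i (ginv y)) i =
      x (Function.update v i vhat) (Function.update s i (ghat y)) i := by
  apply ae_eq_of_cross (fun y => x v (Function.update s i (ginv y)) i)
    (fun y => x (Function.update v i vhat) (Function.update s i (ghat y)) i)
  intro y hy z hz
  have ey := hginv y ⟨(le_max_left _ _).trans (hL ▸ hy.1), (hU ▸ hy.2 : y ≤ _).trans (min_le_left _ _)⟩
  have ez := hghat z ⟨(le_max_right _ _).trans (hL ▸ hz.1), (hU ▸ hz.2 : z ≤ _).trans (min_le_right _ _)⟩
  have hval' : ∀ j, ValidVal (Function.update v i vhat j) := by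
    intro j
    by_cases hj : j = i
    · subst hj; simpa using hvhat
    · simpa [hj] using hval j
  have A := hIC v (Function.update s i (ginv y)) i vhat (ghat z) hval hvhat
  have B := hIC (Function.update v i vhat) (Function.update s i (ghat z)) i (v i) (ginv y)
    hval' (hval i)
  simp only [Function.update_idem, Function.update_self, Function.update_eq_self, ey, ez] at A B
  nlinarith
end

section
/- Feasibility from a proper coloring of the dependency graph: Let n ≥ 2 agents have nonnegative valuation functions v_1,…,v_n : [0,1]^n → ℝ, each monotone non-decreasing in every coordinate, and let s ∈ [0,1]^n be a signal profile. Let χ ≥ 1 be a real number and let c : {1,…,n} → C be a proper coloring of the directed graph G_{v,s} using a color set C with |C| ≤ χ. Then ∑_{i=1}^n 1/(χ·(1 + ln n)·(|D_i(v,s)| + 1)) ≤ 1. -/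
open Function

/-- The set `D_i(v,s)` of agents `j ≠ i` with `v_j(1_i, s_{-i}) ≥ v_i(s)` and
`v_j(0_i, s_{-i}) ≥ (1 − 1/log₂ n)·v_i(s)`. -/
def Dset (n : ℕ) (v : Fin n → Sig n → ℝ) (s : Sig n) (i : Fin n) : Set (Fin n) :=
  {j | j ≠ i ∧ v i s ≤ v j (Function.update s i 1) ∧
    (1 - 1 / Real.logb 2 (n : ℝ)) * v i s ≤ v j (Function.update s i 0)}

/-- The edge relation of the directed dependency graph `G_{v,s}`: `j → i` iff `j ≠ i`,
`v_j(s) ≥ v_i(s)` and `v_j(0_i, s_{-i}) < (1 − 1/log₂ n)·v_i(s)`. -/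
def GEdge (n : ℕ) (v : Fin n → Sig n → ℝ) (s : Sig n) (j i : Fin n) : Prop :=
  j ≠ i ∧ v i s ≤ v j s ∧
    v j (Function.update s i 0) < (1 - 1 / Real.logb 2 (n : ℝ)) * v i s

theorem aux_harm {α : Type*} [DecidableEq α] (f : α → ℝ) (S : Finset α) :
    ∑ i ∈ S, 1 / (((S.filter (fun j => f i ≤ f j)).card : ℝ)) ≤ (harmonic S.card : ℝ) := by
  induction S using Finset.induction_on_min_value f with
  | empty => simp
  | insert a S ha hmin ih =>
    rw [Finset.sum_insert ha, Finset.card_insert_of_notMem ha, harmonic_succ]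
    push_cast
    have h1 : (insert a S).filter (fun j => f a ≤ f j) = insert a S := by
      apply Finset.filter_true_of_mem
      intro x hx
      rcases Finset.mem_insert.1 hx with rfl | hx
      · exact le_rfl
      · exact hmin x hx
    rw [h1, Finset.card_insert_of_notMem ha]
    push_cast
    have h2 : ∑ i ∈ S, 1 / ((((insert a S).filter (fun j => f i ≤ f j)).card : ℝ))
        ≤ ∑ i ∈ S, 1 / (((S.filter (fun j => f i ≤ f j)).card : ℝ)) := by
      apply Finset.sum_le_sum
      intro i hi
      apply one_div_le_one_div_of_le
      · have : 0 < (S.filter (fun j => f i ≤ f j)).card :=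
          Finset.card_pos.2 ⟨i, by simp [hi]⟩
        exact_mod_cast this
      · exact_mod_cast Finset.card_le_card
          (Finset.filter_subset_filter _ (Finset.subset_insert a S))
    rw [one_div]
    linarith

/-- feasibility from a proper coloring of the dependency graph.  If
`c : Fin n → C` is a proper coloring of `G_{v,s}` with `|C| ≤ χ` colors, `χ ≥ 1`, then
`∑_i 1/(χ·(1 + ln n)·(|D_i(v,s)| + 1)) ≤ 1`. -/
theorem stmt6 (n : ℕ) (hn : 2 ≤ n)
    (v : Fin n → Sig n → ℝ) (hval : ∀ j, ValidVal (v j)) (s : Sig n)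
    (χ : ℝ) (hχ : 1 ≤ χ)
    (C : Type) [Fintype C] (hC : (Fintype.card C : ℝ) ≤ χ)
    (c : Fin n → C)
    (hproper : ∀ j i : Fin n, GEdge n v s j i → c j ≠ c i) :
    ∑ i : Fin n, 1 / (χ * (1 + Real.log (n : ℝ)) * (((Dset n v s i).ncard : ℝ) + 1)) ≤ 1 := by
  classical
  have hlog : 0 ≤ Real.log (n : ℝ) := Real.log_natCast_nonneg n
  have hL : 0 < 1 + Real.log (n : ℝ) := by linarith
  have hX : 0 < χ := by linarith
  have hclass : ∀ k : C, ∑ i ∈ Finset.univ.filter (fun i => c i = k),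
      1 / (((Dset n v s i).ncard : ℝ) + 1) ≤ 1 + Real.log (n : ℝ) := by
    intro k
    set S := (Finset.univ : Finset (Fin n)).filter (fun i => c i = k) with hS
    have hcard : S.card ≤ n := by
      simpa using Finset.card_le_univ S
    have h1 : ∑ i ∈ S, 1 / (((Dset n v s i).ncard : ℝ) + 1)
        ≤ ∑ i ∈ S, 1 / (((S.filter (fun j => v i s ≤ v j s)).card : ℝ)) := by
      apply Finset.sum_le_sum
      intro i hi
      apply one_div_le_one_div_of_le
      · have : 0 < (S.filter (fun j => v i s ≤ v j s)).card :=
          Finset.card_pos.2 ⟨i, by simp [hi]⟩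
        exact_mod_cast this
      · have hsub : (((S.filter (fun j => v i s ≤ v j s)).erase i : Finset (Fin n)) : Set (Fin n))
            ⊆ Dset n v s i := by
          intro j hj
          simp only [Finset.coe_erase, Finset.coe_filter, Set.mem_sdiff, Set.mem_ofPred_eq,
            Set.mem_singleton_iff] at hj
          obtain ⟨⟨hjS, hle⟩, hne⟩ := hj
          refine ⟨hne, hle.trans ((hval j).2 ?_), ?_⟩
          · rw [le_update_iff]
            exact ⟨unitInterval.le_one', fun _ _ => le_rfl⟩
          · by_contra hlt
            refine hproper j i ⟨hne, hle, not_le.1 hlt⟩ ?_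
            rw [(Finset.mem_filter.1 hjS).2, (Finset.mem_filter.1 hi).2]
        have h2 := Set.ncard_le_ncard hsub (Set.toFinite _)
        rw [Set.ncard_coe_finset] at h2
        have h3 := Finset.pred_card_le_card_erase (s := S.filter (fun j => v i s ≤ v j s)) (a := i)
        exact_mod_cast (by omega : (S.filter (fun j => v i s ≤ v j s)).card
          ≤ (Dset n v s i).ncard + 1)
    refine h1.trans ((aux_harm (fun i => v i s) S).trans ?_)
    refine (harmonic_le_one_add_log _).trans ?_
    rcases Nat.eq_zero_or_pos S.card with h0 | h0
    · rw [h0]; simpa using hlog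
    · have := Real.log_le_log (by exact_mod_cast h0 : (0 : ℝ) < S.card)
        (by exact_mod_cast hcard : (S.card : ℝ) ≤ n)
      linarith
  have htot : ∑ i : Fin n, 1 / (((Dset n v s i).ncard : ℝ) + 1)
      ≤ χ * (1 + Real.log (n : ℝ)) := by
    rw [← Finset.sum_fiberwise (s := Finset.univ) (g := c)]
    refine (Finset.sum_le_sum (fun k _ => hclass k)).trans ?_
    rw [Finset.sum_const, nsmul_eq_mul, Finset.card_univ]
    exact mul_le_mul_of_nonneg_right hC hL.le
  have hP : 0 < χ * (1 + Real.log (n : ℝ)) := mul_pos hX hL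
  calc _ = (∑ i : Fin n, 1 / (((Dset n v s i).ncard : ℝ) + 1)) / (χ * (1 + Real.log (n : ℝ))) := by
        rw [Finset.sum_div]
        refine Finset.sum_congr rfl fun i _ => ?_
        rw [div_div, mul_comm]
    _ ≤ 1 := (div_le_one hP).2 htot
end

section
/- Out-degree bound for the dependency graph under SOS valuations: Let n ≥ 2 agents have nonnegative valuation functions v_1,…,v_n : [0,1]^n → ℝ, each monotone non-decreasing in every coordinate and submodular over signals, and let s ∈ [0,1]^n. Then for every agent j, the set P_j = { i ≠ j : v_j(s) ≥ v_i(s) and v_j(0_i, s_{-i}) < (1 − 1/log₂ n)·v_i(s) } satisfies |P_j| ≤ log₂ n; equivalently, every vertex of the directed graph G_{v,s} has out-degree at most ⌊log₂ n⌋. -/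
open Function

/-- Submodularity over signals. -/
def SOS {n : ℕ} (v : Sig n → ℝ) : Prop :=
  ∀ (i : Fin n) (s s' : Sig n) (t : unitInterval),
    s ≤ s' → s i = s' i → s i ≤ t →
    v (Function.update s' i t) - v s' ≤ v (Function.update s i t) - v s

theorem sos_sum_drop {n : ℕ} (v : Sig n → ℝ) (hv : SOS v) (s : Sig n) (S : Finset (Fin n)) :
    v (fun k => if k ∈ S then 0 else s k) + ∑ i ∈ S, (v s - v (Function.update s i 0)) ≤ v s := by
  induction S using Finset.induction_on with
  | empty => simp
  | insert i S hi ih =>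
    rw [Finset.sum_insert hi]
    have h := hv i (fun k => if k ∈ insert i S then 0 else s k) (Function.update s i 0) (s i)
      (by
        intro k
        by_cases hk : k = i
        · subst hk; simp
        · by_cases hS : k ∈ S
          · simp [hk, hS]
          · simp [hk, hS])
      (by simp)
      (by simp)
    have e1 : Function.update (Function.update s i 0) i (s i) = s := by simp
    have e2 : Function.update (fun k => if k ∈ insert i S then 0 else s k) i (s i)
        = (fun k => if k ∈ S then 0 else s k) := by
      funext k
      by_cases hk : k = i
      · subst hk; simp [hi]
      · simp [hk]
    rw [e1, e2] at h
    linarith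

/-- out-degree bound for the dependency graph under SOS valuations.
For every agent `j`, the set `P_j` of agents `i ≠ j` with `v_j(s) ≥ v_i(s)` and
`v_j(0_i, s_{-i}) < (1 − 1/log₂ n)·v_i(s)` has size at most `log₂ n`. -/
theorem stmt9 (n : ℕ) (hn : 2 ≤ n)
    (v : Fin n → Sig n → ℝ) (hval : ∀ j, ValidVal (v j)) (hsos : ∀ j, SOS (v j))
    (s : Sig n) :
    ∀ j : Fin n,
      (({i : Fin n | i ≠ j ∧ v i s ≤ v j s ∧
        v j (Function.update s i 0) < (1 - 1 / Real.logb 2 (n : ℝ)) * v i s}).ncard : ℝ)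
        ≤ Real.logb 2 (n : ℝ) := by
  intro j
  classical
  set L := Real.logb 2 (n : ℝ) with hL
  have hL1 : 1 ≤ L := by
    have hn' : (2 : ℝ) ≤ n := by exact_mod_cast hn
    rw [hL, Real.le_logb_iff_rpow_le (by norm_num) (by linarith)]
    simpa using hn'
  have hL0 : 0 < L := by linarith
  have hc : 0 ≤ 1 - 1 / L := by
    have : 1 / L ≤ 1 := by rw [div_le_one hL0]; exact hL1
    linarith
  set P : Set (Fin n) := {i : Fin n | i ≠ j ∧ v i s ≤ v j s ∧
        v j (Function.update s i 0) < (1 - 1 / L) * v i s} with hP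
  rw [Set.ncard_eq_toFinset_card']
  have key := sos_sum_drop (v j) (hsos j) s P.toFinset
  have h0 := (hval j).1 (fun k => if k ∈ P.toFinset then 0 else s k)
  have hdrop : ∀ i ∈ P.toFinset, v j s / L ≤ v j s - v j (Function.update s i 0) := by
    intro i hi
    rw [Set.mem_toFinset] at hi
    obtain ⟨_, h2, h3⟩ := hi
    have h4 := mul_le_mul_of_nonneg_left h2 hc
    have h5 : (1 - 1 / L) * v j s = v j s - v j s / L := by ring
    linarith
  have hsum := Finset.card_nsmul_le_sum _ _ _ hdrop
  rw [nsmul_eq_mul] at hsum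
  rcases P.toFinset.eq_empty_or_nonempty with he | ⟨i, hi⟩
  · rw [he]; simpa using hL0.le
  · rw [Set.mem_toFinset] at hi
    obtain ⟨_, h2, h3⟩ := hi
    have h4 := (hval j).1 (Function.update s i 0)
    have h5 : 0 < v i s := pos_of_mul_pos_right (lt_of_le_of_lt h4 h3) hc
    have hV : 0 < v j s := by linarith
    have h6 : (P.toFinset.card : ℝ) * (v j s / L) ≤ v j s := by linarith
    rw [← mul_div_assoc, div_le_iff₀ hL0, mul_comm (v j s)] at h6
    exact le_of_mul_le_mul_right h6 hV
end

section
/- Coloring number bound for the dependency graph under SOS valuations: Let n ≥ 2 agents have nonnegative valuation functions v_1,…,v_n : [0,1]^n → ℝ, each monotone non-decreasing in every coordinate and submodular over signals, and let s ∈ [0,1]^n. Then the directed graph G_{v,s} admits a proper coloring with at most 2·⌊log₂ n⌋ + 1 colors (in particular, its chromatic number is at most 2·log₂ n + 1). -/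
open Function

theorem color_aux {α : Type*} [DecidableEq α] (E : α → α → Prop) [DecidableRel E] (k : ℕ)
    (hE : ∀ (S : Finset α) (j : α), (S.filter (fun i => E j i)).card ≤ k)
    (hirr : ∀ j, ¬ E j j) (S : Finset α) :
    ∃ c : α → Fin (2 * k + 1), ∀ j ∈ S, ∀ i ∈ S, E j i → c j ≠ c i := by
  induction hm : S.card generalizing S with
  | zero =>
    rw [Finset.card_eq_zero] at hm
    subst hm
    exact ⟨fun _ => 0, by simp⟩
  | succ m ih =>
    have hne : S.Nonempty := by
      rw [← Finset.card_pos]; omega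
    obtain ⟨x, hx, hdeg⟩ : ∃ x ∈ S, (S.filter (fun i => E x i)).card +
        (S.filter (fun i => E i x)).card ≤ 2 * k := by
      by_contra! hcon
      have h1 := Finset.sum_lt_sum_of_nonempty hne hcon
      rw [Finset.sum_add_distrib] at h1
      have h2 : ∑ x ∈ S, (S.filter (fun i => E i x)).card
          = ∑ x ∈ S, (S.filter (fun i => E x i)).card := by
        simp only [Finset.card_filter]
        rw [Finset.sum_comm]
      have h3 : ∑ x ∈ S, (S.filter (fun i => E x i)).card ≤ ∑ x ∈ S, k :=
        Finset.sum_le_sum (fun x _ => hE S x)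
      simp only [Finset.sum_const, smul_eq_mul] at h1 h3
      rw [h2] at h1
      nlinarith
    obtain ⟨c, hc⟩ := ih (S.erase x) (by rw [Finset.card_erase_of_mem hx]; omega)
    obtain ⟨a, ha⟩ : ∃ a : Fin (2 * k + 1),
        a ∉ ((S.filter (fun i => E x i)) ∪ (S.filter (fun i => E i x))).image c := by
      by_contra! hcon
      have h1 := Finset.eq_univ_of_forall hcon
      have h2 := congrArg Finset.card h1
      rw [Finset.card_univ, Fintype.card_fin] at h2
      have h3 : _ ≤ _ := Finset.card_image_le (f := c)
        (s := (S.filter (fun i => E x i)) ∪ (S.filter (fun i => E i x)))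
      have h4 := Finset.card_union_le (S.filter (fun i => E x i)) (S.filter (fun i => E i x))
      omega
    simp only [Finset.mem_image, Finset.mem_union, Finset.mem_filter, not_exists, not_and] at ha
    refine ⟨Function.update c x a, fun j hj i hi hji => ?_⟩
    by_cases h1 : j = x
    · by_cases h2 : i = x
      · subst h1; subst h2; exact absurd hji (hirr _)
      · subst h1
        rw [Function.update_self, Function.update_of_ne h2]
        exact fun h => ha i (Or.inl ⟨hi, hji⟩) h.symm
    · by_cases h2 : i = x
      · subst h2
        rw [Function.update_self, Function.update_of_ne h1]
        exact ha j (Or.inr ⟨hj, hji⟩)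
      · rw [Function.update_of_ne h1, Function.update_of_ne h2]
        exact hc j (Finset.mem_erase.2 ⟨h1, hj⟩) i (Finset.mem_erase.2 ⟨h2, hi⟩) hji

theorem sos_sum {n : ℕ} (v : Sig n → ℝ) (hs : SOS v) (s : Sig n) (T : Finset (Fin n)) :
    ∑ i ∈ T, (v s - v (Function.update s i 0)) ≤ v s - v (fun l => if l ∈ T then 0 else s l) := by
  induction T using Finset.induction_on with
  | empty => simp
  | insert i T hi ih =>
    rw [Finset.sum_insert hi]
    have h := hs i (fun l => if l ∈ insert i T then 0 else s l) (Function.update s i 0) (s i)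
      (by
        intro l
        by_cases h1 : l = i
        · subst h1; simp
        · by_cases h2 : l ∈ T
          · simp [h1, h2, unitInterval.nonneg']
          · simp [h1, h2])
      (by simp) (by simp [unitInterval.nonneg'])
    have e1 : Function.update (Function.update s i 0) i (s i) = s := by simp
    have e2 : Function.update (fun l => if l ∈ insert i T then 0 else s l) i (s i)
        = (fun l => if l ∈ T then 0 else s l) := by
      funext l
      by_cases h1 : l = i
      · subst h1; simp [hi]
      · simp [h1]
    rw [e1, e2] at h
    linarith

/-- coloring number bound for the dependency graph under SOS valuations.
`G_{v,s}` admits a proper coloring with at most `2·⌊log₂ n⌋ + 1` colors. -/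
theorem stmt10 (n : ℕ) (hn : 2 ≤ n)
    (v : Fin n → Sig n → ℝ) (hval : ∀ j, ValidVal (v j)) (hsos : ∀ j, SOS (v j))
    (s : Sig n) :
    ∃ c : Fin n → Fin (2 * Nat.log 2 n + 1),
      ∀ j i : Fin n, GEdge n v s j i → c j ≠ c i := by
  classical
  have hL : (1:ℝ) ≤ Real.logb 2 n := by
    rw [Real.le_logb_iff_rpow_le (by norm_num) (by positivity)]
    simpa using (by exact_mod_cast hn : (2:ℝ) ≤ n)
  have hL2 : Real.logb 2 n < Nat.log 2 n + 1 := by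
    rw [Real.logb_lt_iff_lt_rpow (by norm_num) (by positivity)]
    have := Nat.lt_pow_succ_log_self (b := 2) (by norm_num) n
    exact_mod_cast this
  have hinv : 0 ≤ 1 - 1 / Real.logb 2 n := by
    rw [sub_nonneg, div_le_one (by linarith)]; exact hL
  obtain ⟨c, hc⟩ := color_aux (GEdge n v s) (Nat.log 2 n) (by
    intro S j
    by_contra! hcon
    set T := S.filter (fun i => GEdge n v s j i) with hT
    have hTne : T.Nonempty := by
      rw [← Finset.card_pos]; omega
    have hsum := sos_sum (v j) (hsos j) s T
    have hnn := (hval j).1 (fun l => if l ∈ T then 0 else s l)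
    have hlt : ∑ i ∈ T, (v j s / Real.logb 2 n)
        < ∑ i ∈ T, (v j s - v j (Function.update s i 0)) := by
      refine Finset.sum_lt_sum_of_nonempty hTne (fun i hi => ?_)
      obtain ⟨-, h1, h2⟩ := (Finset.mem_filter.1 hi).2
      have h3 := mul_le_mul_of_nonneg_left h1 hinv
      have h4 : (1 - 1 / Real.logb 2 n) * v j s = v j s - v j s / Real.logb 2 n := by ring
      linarith
    rw [Finset.sum_const, nsmul_eq_mul] at hlt
    have h5 : (T.card : ℝ) * (v j s / Real.logb 2 n) < v j s := by linarith
    have h6 : (Nat.log 2 n : ℝ) + 1 ≤ T.card := by exact_mod_cast hcon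
    have h7 : 0 ≤ v j s / Real.logb 2 n := div_nonneg ((hval j).1 s) (by linarith)
    have h8 : Real.logb 2 n * (v j s / Real.logb 2 n) = v j s :=
      mul_div_cancel₀ _ (by linarith)
    have h9 := mul_le_mul_of_nonneg_right (hL2.le.trans h6) h7
    linarith) (fun j h => h.1 rfl) Finset.univ
  exact ⟨c, fun j i h => hc j (Finset.mem_univ _) i (Finset.mem_univ _) h⟩
end

section
/- 2(k+1)-approximation for k-bounded dependency: Let n agents have nonnegative valuation functions v_1,…,v_n : [0,1]^n → ℝ, each monotone non-decreasing in every coordinate. For each i let B_i = { j ≠ i : ∃ s ∈ [0,1]^n with v_i(s) > v_i(0_j, s_{-j}) }, and let k = max_i |B_i|. Fix a signal profile s ∈ [0,1]^n. For j ≠ i let T^{(i)}_j = v_j(0_i, s_{-i}). Call agent i a candidate if for every j ≠ i, either v_i(s) > T^{(i)}_j, or v_i(s) = T^{(i)}_j and i < j. Define x_i = (1/2)·1/( max{ |B_j| : j such that i ∈ B_j } + 1 ) if i is a candidate (the maximum over an empty set being 0), and x_i = 0 otherwise. Then: (a) ∑_{i=1}^n x_i ≤ 1; (b) ∑_{i=1}^n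 x_i·v_i(s) ≥ (1/(2(k+1)))·max_i v_i(s); and (c) for every agent i, with the other agents' valuations and signals fixed, x_i depends on (v_i, s_i) only through the value v_i(s) and is monotone non-decreasing in that value. -/
open Function

/-- `B_i`: the set of agents `j ≠ i` whose signal agent `i`'s valuation depends on. -/
def Bdep {n : ℕ} (v : Fin n → Sig n → ℝ) (i : Fin n) : Set (Fin n) :=
  {j | j ≠ i ∧ ∃ s : Sig n, v i (Function.update s j 0) < v i s}

/-- Agent `i` is a candidate: for every `j ≠ i`, either `v_i(s) > T^{(i)}_j`, or
`v_i(s) = T^{(i)}_j` and `i < j` (lexicographic tie-breaking), where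
`T^{(i)}_j = v_j(0_i, s_{-i})`. -/
def Cand {n : ℕ} (v : Fin n → Sig n → ℝ) (s : Sig n) (i : Fin n) : Prop :=
  ∀ j, j ≠ i → (v j (Function.update s i 0) < v i s ∨
    (v i s = v j (Function.update s i 0) ∧ i < j))

open Classical in
/-- The allocation of the `k`-bounded dependency mechanism: a candidate `i` receives the
item with probability `(1/2)·1/(max{ |B_j| : j with i ∈ B_j } + 1)` (the maximum over an
empty set being `0`), and a non-candidate receives it with probability `0`. -/
noncomputable def xk {n : ℕ} (v : Fin n → Sig n → ℝ) (s : Sig n) (i : Fin n) : ℝ :=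
  if Cand v s i then
    (1 / 2) * (1 / (((sSup {m : ℕ | ∃ j, i ∈ Bdep v j ∧ (Bdep v j).ncard = m} : ℕ) : ℝ) + 1))
  else 0

/-- The maximum appearing in the denominator of `xk`. -/
noncomputable def degSup {n : ℕ} (v : Fin n → Sig n → ℝ) (i : Fin n) : ℕ :=
  sSup {m : ℕ | ∃ j, i ∈ Bdep v j ∧ (Bdep v j).ncard = m}

lemma xk_cand {n : ℕ} {v : Fin n → Sig n → ℝ} {s : Sig n} {i : Fin n} (h : Cand v s i) :
    xk v s i = (1 / 2) * (1 / ((degSup v i : ℝ) + 1)) := by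
  unfold xk degSup
  rw [if_pos h]

lemma xk_not {n : ℕ} {v : Fin n → Sig n → ℝ} {s : Sig n} {i : Fin n} (h : ¬ Cand v s i) :
    xk v s i = 0 := by
  unfold xk
  rw [if_neg h]

lemma xk_nonneg {n : ℕ} (v : Fin n → Sig n → ℝ) (s : Sig n) (i : Fin n) : 0 ≤ xk v s i := by
  by_cases h : Cand v s i
  · rw [xk_cand h]; positivity
  · rw [xk_not h]

lemma xk_le_half {n : ℕ} (v : Fin n → Sig n → ℝ) (s : Sig n) (i : Fin n) :
    xk v s i ≤ 1 / 2 := by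
  by_cases h : Cand v s i
  · rw [xk_cand h]
    have : (1 : ℝ) / ((degSup v i : ℝ) + 1) ≤ 1 := by
      rw [div_le_one (by positivity)]
      have : (0 : ℝ) ≤ degSup v i := by positivity
      linarith
    linarith
  · rw [xk_not h]; norm_num

/-- A maximizer of `v_i(s)` with least index. -/
lemma exists_lead {n : ℕ} (v : Fin n → Sig n → ℝ) (s : Sig n)
    (M : ℝ) (hM : IsGreatest (Set.range fun i => v i s) M) :
    ∃ i, v i s = M ∧ (∀ j, v j s ≤ M) ∧ ∀ j, v j s = M → i ≤ j := by
  classical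
  obtain ⟨⟨i0, hi0⟩, hub⟩ := hM
  have hne : (Finset.univ.filter fun i => v i s = M).Nonempty := ⟨i0, by simpa using hi0⟩
  refine ⟨_, (Finset.mem_filter.1 (Finset.min'_mem _ hne)).2, fun j => hub ⟨j, rfl⟩, ?_⟩
  intro j hj
  exact Finset.min'_le _ _ (by simpa using hj)

lemma update_zero_le {n : ℕ} (s : Sig n) (i : Fin n) : Function.update s i 0 ≤ s := by
  intro j
  by_cases h : j = i
  · subst h; simp
  · simp [h]

lemma degSup_update {n : ℕ} (v : Fin n → Sig n → ℝ) (i : Fin n) (w : Sig n → ℝ) :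
    degSup (Function.update v i w) i = degSup v i := by
  have hB : ∀ j, j ≠ i → Bdep (Function.update v i w) j = Bdep v j := by
    intro j hj
    simp [Bdep, hj]
  unfold degSup
  congr 1
  ext m
  constructor
  · rintro ⟨j, hj, hm⟩
    have hji : j ≠ i := fun h => hj.1 h.symm
    rw [hB j hji] at hj hm
    exact ⟨j, hj, hm⟩
  · rintro ⟨j, hj, hm⟩
    have hji : j ≠ i := fun h => hj.1 h.symm
    refine ⟨j, ?_, ?_⟩
    · rw [hB j hji]; exact hj
    · rw [hB j hji]; exact hm

lemma cand_update {n : ℕ} (v : Fin n → Sig n → ℝ) (s : Sig n) (i : Fin n)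
    (w : Sig n → ℝ) (t : unitInterval) :
    Cand (Function.update v i w) (Function.update s i t) i ↔
      ∀ j, j ≠ i → (v j (Function.update s i 0) < w (Function.update s i t) ∨
        (w (Function.update s i t) = v j (Function.update s i 0) ∧ i < j)) := by
  unfold Cand
  refine forall_congr' fun j => imp_congr_right fun hj => ?_
  simp [hj]

/-- the `2(k+1)`-approximation mechanism for `k`-bounded dependency.
With `k = max_i |B_i|` and `M = max_i v_i(s)`:
(a) the allocation is feasible; (b) the expected welfare is at least `M/(2(k+1))`;
(c) for each agent `i`, fixing the others' reports, the allocation depends on `i`'s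
reported valuation and signal only through the value `v_i(s)`, monotonically. -/
theorem stmt15 (n : ℕ)
    (v : Fin n → Sig n → ℝ) (hval : ∀ i, ValidVal (v i))
    (k : ℕ) (hk : IsGreatest (Set.range fun i => (Bdep v i).ncard) k)
    (s : Sig n)
    (M : ℝ) (hM : IsGreatest (Set.range fun i => v i s) M) :
    (∑ i : Fin n, xk v s i ≤ 1) ∧
    ((1 / (2 * ((k : ℝ) + 1))) * M ≤ ∑ i : Fin n, xk v s i * v i s) ∧
    (∀ (i : Fin n) (v₁ v₂ : Sig n → ℝ) (s₁ s₂ : unitInterval),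
      ValidVal v₁ → ValidVal v₂ →
      v₁ (Function.update s i s₁) ≤ v₂ (Function.update s i s₂) →
      xk (Function.update v i v₁) (Function.update s i s₁) i ≤
        xk (Function.update v i v₂) (Function.update s i s₂) i) := by
  obtain ⟨l, hl, hle, hlmin⟩ := exists_lead v s M hM
  have hdeg : ∀ i, degSup v i ≤ k := by
    intro i
    refine csSup_le' ?_
    rintro m ⟨j, -, rfl⟩
    exact hk.2 ⟨j, rfl⟩
  refine ⟨?_, ?_, ?_⟩
  · classical
    set b : ℕ := (Bdep v l).ncard with hb
    have hcand : ∀ i, i ≠ l → Cand v s i → i ∈ Bdep v l := by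
      intro i hil hc
      by_contra hn
      have heq : v l s ≤ v l (Function.update s i 0) := by
        by_contra hlt
        exact hn ⟨hil, s, not_le.1 hlt⟩
      rcases hc l hil.symm with h | ⟨h, hlt⟩
      · have := hle i
        linarith
      · have h1 := hle i
        have h2 : v i s = M := by linarith
        exact absurd (hlmin i h2) (not_le.2 hlt)
    have hbound : ∀ i ∈ Bdep v l, xk v s i ≤ (1 / 2) * (1 / ((b : ℝ) + 1)) := by
      intro i hi
      by_cases hc : Cand v s i
      · rw [xk_cand hc]
        have h1 : b ≤ degSup v i := by
          refine le_csSup ⟨k, ?_⟩ ⟨l, hi, rfl⟩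
          rintro m ⟨j, -, rfl⟩
          exact hk.2 ⟨j, rfl⟩
        have h2 : (b : ℝ) ≤ degSup v i := by exact_mod_cast h1
        gcongr
      · rw [xk_not hc]; positivity
    have hsum : ∑ i ∈ Finset.univ.erase l, xk v s i
        ≤ (b : ℝ) * ((1 / 2) * (1 / ((b : ℝ) + 1))) := by
      have hcard : (Bdep v l).toFinset.card = b := by
        rw [hb, Set.ncard_eq_toFinset_card']
      rw [← nsmul_eq_mul]
      have hs : ∑ i ∈ (Bdep v l).toFinset, xk v s i = ∑ i ∈ Finset.univ.erase l, xk v s i := by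
        refine Finset.sum_subset ?_ ?_
        · intro i hi
          simp only [Set.mem_toFinset] at hi
          simpa using hi.1
        · intro i hi hn
          simp only [Set.mem_toFinset] at hn
          refine xk_not fun hc => hn (hcand i (by simpa using hi) hc)
      rw [← hs]
      have := Finset.sum_le_card_nsmul (Bdep v l).toFinset (fun i => xk v s i) _
        (fun i hi => hbound i (by simpa using hi))
      rwa [hcard] at this
    rw [← Finset.add_sum_erase _ _ (Finset.mem_univ l)]
    have h1 := xk_le_half v s l
    have h2 : (b : ℝ) * ((1 / 2) * (1 / ((b : ℝ) + 1))) ≤ 1 / 2 := by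
      have : (b : ℝ) / ((b : ℝ) + 1) ≤ 1 := by
        rw [div_le_one (by positivity)]
        linarith
      calc (b : ℝ) * ((1 / 2) * (1 / ((b : ℝ) + 1))) = (1 / 2) * ((b : ℝ) / ((b : ℝ) + 1)) := by ring
        _ ≤ 1 / 2 := by linarith
    linarith
  · have hc : Cand v s l := by
      intro j hj
      have h1 : v j (Function.update s l 0) ≤ v j s := (hval j).2 (update_zero_le s l)
      have h2 := hle j
      rcases lt_or_eq_of_le (h1.trans h2) with h | h
      · left; linarith
      · right
        refine ⟨by linarith, lt_of_le_of_ne (hlmin j (by linarith)) hj.symm⟩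
    have hterm : (1 / (2 * ((k : ℝ) + 1))) * M ≤ xk v s l * v l s := by
      rw [hl, xk_cand hc]
      have hM0 : 0 ≤ M := hl ▸ (hval l).1 s
      refine mul_le_mul_of_nonneg_right ?_ hM0
      have h2 : (degSup v l : ℝ) ≤ k := by exact_mod_cast hdeg l
      calc (1 / (2 * ((k : ℝ) + 1))) = (1 / 2) * (1 / ((k : ℝ) + 1)) := by field_simp
        _ ≤ _ := by gcongr
    refine hterm.trans ?_
    exact Finset.single_le_sum (f := fun i => xk v s i * v i s)
      (fun i _ => mul_nonneg (xk_nonneg v s i) ((hval i).1 s)) (Finset.mem_univ l)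
  · intro i v₁ v₂ s₁ s₂ _ _ h
    by_cases hc : Cand (Function.update v i v₁) (Function.update s i s₁) i
    · have hc2 : Cand (Function.update v i v₂) (Function.update s i s₂) i := by
        rw [cand_update] at hc ⊢
        intro j hj
        rcases hc j hj with h1 | ⟨h1, h2⟩
        · left; linarith
        · rcases lt_or_eq_of_le h with h3 | h3
          · left; linarith
          · right; exact ⟨by linarith, h2⟩
      rw [xk_cand hc, xk_cand hc2, degSup_update, degSup_update]
    · rw [xk_not hc]
      exact xk_nonneg _ _ _
end

section
/- Lower bound of k+1 with public valuations and k-bounded dependency: For every k ≥ 1, every n ≥ k+1, and every δ > 0, there exists a profile of nonnegative valuation functions v_1,…,v_n : [0,1]^n → ℝ, each monotone non-decreasing in every coordinate and with |B_i| ≤ k for every i, such that: for every allocation rule x : [0,1]^n → [0,1]^n satisfying feasibility (∑_{i=1}^n x_i(s) ≤ 1 for every s ∈ [0,1]^n) and per-agent signal monotonicity (for every i and every fixed s_{-i}, the map s_i ↦ x_i(s_i, s_{-i}) is monotone non-decreasing — a necessary condition for ex-post IC implementability with public valuations), there exists a signal profile s ∈ [0,1]^n with max_i v_i(s) > 0 and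 ∑_{i=1}^n x_i(s)·v_i(s) ≤ (1/(k+1))·max_i v_i(s) + δ. -/
open Function

open Classical in
/-- The hard instance: agents `0,…,k` form a group; the value of a group member is `1` exactly when
all the other group members have signal `1`. All other values are `0`. -/
noncomputable def hardVal (k n : ℕ) (i : Fin n) (s : Sig n) : ℝ :=
  if i.val < k + 1 ∧ ∀ j : Fin n, j.val < k + 1 → j ≠ i → s j = 1 then 1 else 0

/-- lower bound of `k+1` with public valuations and `k`-bounded
dependency.  For every `k ≥ 1`, `n ≥ k+1` and `δ > 0`, there is a profile of valid
valuations with `|B_i| ≤ k` for all `i` such that every feasible allocation rule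
(taking values in `[0,1]`) that is monotone non-decreasing in each agent's own signal
obtains, on some signal profile with positive optimal welfare, welfare at most
`(1/(k+1))·max_i v_i(s) + δ`. -/
theorem stmt16 (k n : ℕ) (hk : 1 ≤ k) (hn : k + 1 ≤ n) (δ : ℝ) (hδ : 0 < δ) :
    ∃ v : Fin n → Sig n → ℝ,
      (∀ i, ValidVal (v i)) ∧ (∀ i, (Bdep v i).ncard ≤ k) ∧
      ∀ x : Sig n → Fin n → ℝ,
        (∀ s i, x s i ∈ Set.Icc (0:ℝ) 1) →
        (∀ s : Sig n, ∑ i, x s i ≤ 1) →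
        (∀ (i : Fin n) (s : Sig n) (t t' : unitInterval), t ≤ t' →
          x (Function.update s i t) i ≤ x (Function.update s i t') i) →
        ∃ (s : Sig n) (istar : Fin n),
          (∀ j, v j s ≤ v istar s) ∧ 0 < v istar s ∧
          ∑ i, x s i * v i s ≤ (1 / ((k : ℝ) + 1)) * v istar s + δ := by
  classical
  refine ⟨hardVal k n, ?_, ?_, ?_⟩
  · intro i
    refine ⟨fun s => ?_, fun s t hst => ?_⟩
    · unfold hardVal; split_ifs <;> norm_num
    · unfold hardVal
      split_ifs with h1 h2 h2
      · exact le_rfl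
      · exact absurd ⟨h1.1, fun j hj hji =>
          le_antisymm unitInterval.le_one' ((h1.2 j hj hji).symm.le.trans (hst j))⟩ h2
      · norm_num
      · exact le_rfl
  · intro i
    have hsub : Bdep (hardVal k n) i ⊆ {j | i.val < k + 1 ∧ j.val < k + 1 ∧ j ≠ i} := by
      rintro j ⟨hji, s, hs⟩
      unfold hardVal at hs
      split_ifs at hs with h1 h2 h2
      · exact absurd hs (lt_irrefl _)
      · norm_num at hs
      · refine ⟨h2.1, ?_, hji⟩
        by_contra hj
        refine h1 ⟨h2.1, fun l hl hli => ?_⟩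
        rw [Function.update_of_ne (by rintro rfl; exact hj hl)]
        exact h2.2 l hl hli
      · exact absurd hs (lt_irrefl _)
    refine (Set.ncard_le_ncard hsub (Set.toFinite _)).trans ?_
    by_cases hi : i.val < k + 1
    · have hc : (Fin.val '' {j : Fin n | i.val < k + 1 ∧ j.val < k + 1 ∧ j ≠ i}) ⊆
          (((Finset.range (k + 1)).erase i.val : Finset ℕ) : Set ℕ) := by
        rintro _ ⟨j, ⟨_, hj, hji⟩, rfl⟩
        simp only [Finset.coe_erase, Finset.coe_range, Set.mem_sdiff, Set.mem_Iio,
          Set.mem_singleton_iff]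
        exact ⟨hj, fun h => hji (Fin.ext h)⟩
      rw [← Set.ncard_image_of_injective _ Fin.val_injective]
      refine (Set.ncard_le_ncard hc (Set.toFinite _)).trans ?_
      rw [Set.ncard_coe_finset, Finset.card_erase_of_mem (Finset.mem_range.2 hi)]
      simp
    · have : {j : Fin n | i.val < k + 1 ∧ j.val < k + 1 ∧ j ≠ i} = ∅ := by
        ext j; simp [hi]
      rw [this]; simp
  · intro x hx hfeas hmono
    -- some group member gets at most `1/(k+1)` at the all-ones profile
    obtain ⟨a, ha⟩ : ∃ a : Fin (k + 1), x 1 (Fin.castLE hn a) ≤ 1 / ((k : ℝ) + 1) := by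
      by_contra! hcon
      have h1 : ∑ a : Fin (k + 1), x 1 (Fin.castLE hn a) ≤ ∑ i, x 1 i := by
        refine (Finset.sum_map Finset.univ (Fin.castLEEmb hn) (fun i => x 1 i)).symm.le.trans ?_
        exact Finset.sum_le_sum_of_subset_of_nonneg (Finset.subset_univ _)
          (fun i _ _ => (hx 1 i).1)
      have h2 : ∑ _a : Fin (k + 1), 1 / ((k : ℝ) + 1) < ∑ a : Fin (k + 1), x 1 (Fin.castLE hn a) :=
        Finset.sum_lt_sum_of_nonempty Finset.univ_nonempty (fun a _ => hcon a)
      have h3 : ∑ _a : Fin (k + 1), 1 / ((k : ℝ) + 1) = 1 := by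
        simp only [Finset.sum_const, Finset.card_univ, Fintype.card_fin, nsmul_eq_mul]
        push_cast
        field_simp
      linarith [hfeas 1]
    set i := Fin.castLE hn a with hidef
    have hi : i.val < k + 1 := a.2
    have hvi : hardVal k n i (Function.update 1 i 0) = 1 := by
      unfold hardVal
      rw [if_pos]
      refine ⟨hi, fun j _ hji => ?_⟩
      rw [Function.update_of_ne hji]; rfl
    have hvj : ∀ j, j ≠ i → hardVal k n j (Function.update 1 i 0) = 0 := by
      intro j hj
      unfold hardVal
      rw [if_neg]
      rintro ⟨_, h⟩
      have := h i hi hj.symm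
      rw [Function.update_self] at this
      exact zero_ne_one this
    refine ⟨Function.update 1 i 0, i, fun j => ?_, ?_, ?_⟩
    · by_cases hj : j = i
      · rw [hj]
      · rw [hvj j hj, hvi]; norm_num
    · rw [hvi]; norm_num
    · rw [Finset.sum_eq_single i (fun j _ hj => by rw [hvj j hj, mul_zero]) (by simp), hvi]
      have h := hmono i 1 0 1 unitInterval.nonneg'
      have h1 : Function.update (1 : Sig n) i 1 = 1 := Function.update_eq_self i (1 : Sig n)
      rw [h1] at h
      linarith
end

section
/- No finite approximation by deterministic mechanisms under single-crossing with private valuations: Let n = 2 and let (x,p) be a feasible EPIC-IR mechanism that is deterministic, i.e., x_i(v,s) ∈ {0,1} for every agent i and every profile (v,s). Then for every δ > 0 there exist a valuation profile v ∈ V^2 satisfying the single-crossing condition and a signal profile s ∈ [0,1]^2 with max_i v_i(s) > 0 such that ∑_{i=1}^2 x_i(v,s)·v_i(s) ≤ δ·max_i v_i(s). -/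
open Function

/-- The single-crossing condition. -/
def SingleCrossing {n : ℕ} (v : Fin n → Sig n → ℝ) : Prop :=
  ∀ (i j : Fin n) (s : Sig n) (t : unitInterval), s i ≤ t →
    v j (Function.update s i t) - v j s ≤ v i (Function.update s i t) - v i s

lemma fin_other : ∀ i j : Fin 2, j ≠ i → 1 - j = i := by decide

lemma fin_sub_ne : ∀ i : Fin 2, 1 - i ≠ i := by decide

lemma validVal_affine {c M : ℝ} (hc : 0 ≤ c) (hM : 0 ≤ M) (k : Fin 2) :
    ValidVal (fun s : Sig 2 => c + M * (s k : ℝ)) := by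
  constructor
  · intro s
    have := (s k).2.1
    positivity
  · intro s t h
    have h1 : (s k : ℝ) ≤ t k := h k
    have := mul_le_mul_of_nonneg_left h1 hM
    simp only
    linarith

/-- Allocation monotonicity along any unilateral deviation. -/
lemma epic_mono {x p : (Fin 2 → Sig 2 → ℝ) → Sig 2 → Fin 2 → ℝ} (hIC : EPIC 2 x p)
    (v : Fin 2 → Sig 2 → ℝ) (s : Sig 2) (i : Fin 2) (v' : Sig 2 → ℝ) (s' : unitInterval)
    (hv : ∀ j, ValidVal (v j)) (hv' : ValidVal v') :
    0 ≤ (v i s - v' (update s i s')) * (x v s i - x (update v i v') (update s i s') i) := by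
  have h1 := hIC v s i v' s' hv hv'
  have hval : ∀ j, ValidVal (update v i v' j) := by
    intro j
    by_cases h : j = i
    · subst h; simpa using hv'
    · simpa [h] using hv j
  have h2 := hIC (update v i v') (update s i s') i (v i) (s i) hval (hv i)
  simp only [update_idem, update_eq_self, update_self] at h2
  nlinarith

/-- If everything is approximated, agent `i` wins at the all-ones signal profile
when the other agent's value depends on signal `i` and own value on the other's signal. -/
lemma agent_wins {x p : (Fin 2 → Sig 2 → ℝ) → Sig 2 → Fin 2 → ℝ}
    (hrange : ∀ v s i, (∀ j, ValidVal (v j)) → x v s i ∈ Set.Icc (0:ℝ) 1)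
    (hdet : ∀ v s i, (∀ j, ValidVal (v j)) → x v s i = 0 ∨ x v s i = 1)
    (hIC : EPIC 2 x p) {δ : ℝ} (hδ : 0 < δ)
    (hcon : ∀ (v : Fin 2 → Sig 2 → ℝ) (s : Sig 2) (k : Fin 2),
        (∀ j, ValidVal (v j)) → SingleCrossing v →
        (∀ j, v j s ≤ v k s) → 0 < v k s → δ * v k s < ∑ i, x v s i * v i s)
    (w : Fin 2 → Sig 2 → ℝ)
    (hw : w = fun j s => 1 + (1 / δ + 1) * (s (1 - j) : ℝ)) (i : Fin 2) :
    x w (fun _ => 1) i = 1 := by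
  have hd : 0 < 1 / δ := by positivity
  have hdd : δ * (1 / δ) = 1 := by field_simp
  generalize 1 / δ = D at *
  have hwv : ∀ j, ValidVal (w j) := by
    intro j; rw [hw]; exact validVal_affine (by norm_num) (by positivity) _
  let v' : Sig 2 → ℝ := fun s => (1 + D) + (D + 1) * (s i : ℝ)
  have hv' : ValidVal v' := validVal_affine (by positivity) (by positivity) i
  have hmono := epic_mono hIC w (fun _ => 1) i v' 0 hwv hv'
  have hval : ∀ j, ValidVal (update w i v' j) := by
    intro j
    by_cases h : j = i
    · subst h; simpa using hv'
    · simpa [h] using hwv j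
  -- every component is a constant plus the same function
  have hform : ∀ j, ∃ c : ℝ, ∀ s, update w i v' j s = c + (D + 1) * (s i : ℝ) := by
    intro j
    by_cases h : j = i
    · subst h; exact ⟨1 + D, fun s => by simp [v']⟩
    · refine ⟨1, fun s => ?_⟩
      have h2 : 1 - j = i := fin_other i j h
      simp [h, hw, h2]
  have hsc : SingleCrossing (update w i v') := by
    intro a b s t _
    obtain ⟨c, hc⟩ := hform a
    obtain ⟨d, hd⟩ := hform b
    rw [hc, hc, hd, hd]; linarith
  have hi : update w i v' i (update (fun _ => 1) i 0) = 1 + D := by simp [v']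
  have hne : ∀ j, j ≠ i → update w i v' j (update (fun _ => 1) i 0) = 1 := by
    intro j h
    have h2 : 1 - j = i := fin_other i j h
    simp [h, hw, h2]
  have hlt := hcon (update w i v') (update (fun _ => 1) i 0) i hval hsc
    (by
      intro j
      by_cases h : j = i
      · rw [h]
      · rw [hi, hne j h]; linarith)
    (by rw [hi]; linarith)
  have hx1 : x (update w i v') (update (fun _ => 1) i 0) i = 1 := by
    rcases hdet (update w i v') (update (fun _ => 1) i 0) i hval with h | h
    swap
    · exact h
    exfalso
    have hj : (1 - i) ≠ i := fin_sub_ne i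
    have hr := (hrange (update w i v') (update (fun _ => 1) i 0) (1 - i) hval).2
    have hs : ∑ k, x (update w i v') (update (fun _ => 1) i 0) k *
        update w i v' k (update (fun _ => 1) i 0) =
        x (update w i v') (update (fun _ => 1) i 0) (1 - i) := by
      rw [Finset.sum_eq_single (1 - i), hne _ hj, mul_one]
      · intro b _ hb
        have : b = i := by revert hb; clear * -; revert i b; decide
        rw [this, h, zero_mul]
      · simp
    rw [hs, hi] at hlt
    nlinarith
  rw [hx1] at hmono
  have hwi : w i (fun _ => 1) = 2 + D := by simp [hw]; ring
  have hvi : v' (update (fun _ => 1) i 0) = 1 + D := by simp [v']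
  rw [hwi, hvi] at hmono
  rcases hdet w (fun _ => 1) i hwv with h | h
  · rw [h] at hmono; linarith
  · exact h

/-- no finite approximation by deterministic mechanisms under
single-crossing with private valuations (two agents).  For any feasible, deterministic
EPIC-IR mechanism and any `δ > 0`, there exist a single-crossing valuation profile and a
signal profile with positive optimal welfare on which the achieved welfare is at most
`δ·max_i v_i(s)`. -/
theorem stmt18
    (x p : (Fin 2 → Sig 2 → ℝ) → Sig 2 → Fin 2 → ℝ)
    (hrange : ∀ v s i, (∀ j, ValidVal (v j)) → x v s i ∈ Set.Icc (0:ℝ) 1)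
    (hdet : ∀ v s i, (∀ j, ValidVal (v j)) → x v s i = 0 ∨ x v s i = 1)
    (hfeas : ∀ v s, (∀ j, ValidVal (v j)) → ∑ i, x v s i ≤ 1)
    (hIC : EPIC 2 x p) (hIR : EPIR 2 x p) :
    ∀ δ : ℝ, 0 < δ →
      ∃ (v : Fin 2 → Sig 2 → ℝ) (s : Sig 2) (istar : Fin 2),
        (∀ j, ValidVal (v j)) ∧ SingleCrossing v ∧
        (∀ j, v j s ≤ v istar s) ∧ 0 < v istar s ∧
        ∑ i, x v s i * v i s ≤ δ * v istar s := by
  intro δ hδ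
  by_contra hno
  push Not at hno
  have hcon := fun (v : Fin 2 → Sig 2 → ℝ) (s : Sig 2) (k : Fin 2) => hno v s k
  have hwins := agent_wins hrange hdet hIC hδ hcon _ rfl
  have hf := hfeas (fun j s => 1 + (1 / δ + 1) * (s (1 - j) : ℝ)) (fun _ => 1)
    (fun j => validVal_affine (by norm_num) (by positivity) _)
  rw [Fin.sum_univ_two, hwins 0, hwins 1] at hf
  norm_num at hf
end
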